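/- (Cone Lemma.) Let R be a commutative ring, Δ a finite abstract simplicial complex, v a vertex of Δ, and k ≥ 0. The relative simplicial complex (St_v Δ, St_v Δ − v) is resolution k-chordal over R if and only if the link Lk_v Δ is resolution (k−1)-chordal over R. -/

import Mathlib

/-!
Basic notions for homological chordality of simplicial complexes,
following Adiprasito–Nevo–Samper, "Higher chordality: From graphs to complexes".

A finite abstract simplicial complex is modelled as a downward-closed finite
family of finite subsets of a vertex type `V`.  Chains of dimension `k` (with
coefficients in a commutative ring `R`) are functions `Finset V → R` supported
on faces of cardinality `k + 1`; the simplicial boundary operator includes the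
augmentation (so `0`-cycles are *reduced* cycles), matching the paper's
convention that `C₋₁` is generated by the empty face.
-/

open Finset

attribute [local instance] Classical.propDecidable

noncomputable section

/-- A finite abstract simplicial complex with vertices in `V`:
a downward-closed finite family of finite subsets of `V`. -/
structure ASC (V : Type*) where
  faces : Finset (Finset V)
  down_closed : ∀ ⦃s t : Finset V⦄, s ∈ faces → t ⊆ s → t ∈ faces

variable {V : Type*} [Fintype V] [LinearOrder V]

/-- `(-1)` to the number of elements of `t` smaller than `v`; this is the sign
of the position of `v` in the ordered set `insert v t`. -/
def esign (v : V) (t : Finset V) : ℤ :=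
  (-1) ^ (t.filter fun w => w < v).card

/-- The simplicial boundary operator (including the augmentation at the empty
face): `(bdry c) t = ∑_{v ∉ t} ± c (insert v t)`. -/
def bdry {R : Type*} [CommRing R] (c : Finset V → R) : Finset V → R :=
  fun t => ∑ v ∈ tᶜ, esign v t • c (insert v t)

/-- `c` is a chain of dimension `k` on the set of faces `S`:
it is supported on members of `S` of cardinality `k + 1`. -/
def IsChainOn {R : Type*} [CommRing R] (S : Set (Finset V)) (k : ℤ)
    (c : Finset V → R) : Prop :=
  ∀ s : Finset V, c s ≠ 0 → s ∈ S ∧ (s.card : ℤ) = k + 1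

/-- The vertex support `c⁰` of a chain: all vertices lying in a face with a
nonzero coefficient. -/
def vsupp {R : Type*} [CommRing R] (c : Finset V → R) : Set V :=
  {v | ∃ s : Finset V, c s ≠ 0 ∧ v ∈ s}

/-- Vanishing of the `k`-th (reduced) homology of the family of faces `S` over `R`:
every `k`-cycle is the boundary of a `(k+1)`-chain. -/
def HVanish (R : Type*) [CommRing R] (S : Set (Finset V)) (k : ℤ) : Prop :=
  ∀ z : Finset V → R, IsChainOn S k z → bdry z = 0 →
    ∃ c : Finset V → R, IsChainOn S (k + 1) c ∧ bdry c = z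

/-- `Δ` is resolution `k`-chordal over `R`: every `k`-cycle `z` of `Δ` admits a
resolution, i.e. a `(k+1)`-chain `c` of `Δ` with `∂c = z` and the same vertex
support as `z`. -/
def ResChordal (R : Type*) [CommRing R] (Δ : ASC V) (k : ℤ) : Prop :=
  ∀ z : Finset V → R, IsChainOn (↑Δ.faces) k z → bdry z = 0 →
    ∃ c : Finset V → R, IsChainOn (↑Δ.faces) (k + 1) c ∧ bdry c = z ∧ vsupp c = vsupp z

/-- `z` is a complete `k`-cycle on the face set `S`: it is a `k`-cycle whose
faces with nonzero coefficient are precisely all the `k`-dimensional faces of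
some set `W` of `k + 2` vertices, and all those faces belong to `S`. -/
def IsCompleteCycleOn {R : Type*} [CommRing R] (S : Set (Finset V)) (k : ℤ)
    (z : Finset V → R) : Prop :=
  bdry z = 0 ∧ ∃ W : Finset V, (W.card : ℤ) = k + 2 ∧
    (∀ s : Finset V, z s ≠ 0 ↔ s ⊆ W ∧ (s.card : ℤ) = k + 1) ∧
    ∀ s : Finset V, s ⊆ W → (s.card : ℤ) = k + 1 → s ∈ S

/-- `Δ` is decomposition `k`-chordal over `R`: every `k`-cycle `z` of `Δ` is a
sum of complete `k`-cycles of `Δ` supporting only vertices supported in `z`. -/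
def DecChordal (R : Type*) [CommRing R] (Δ : ASC V) (k : ℤ) : Prop :=
  ∀ z : Finset V → R, IsChainOn (↑Δ.faces) k z → bdry z = 0 →
    ∃ (n : ℕ) (zs : Fin n → Finset V → R),
      z = ∑ i, zs i ∧
      ∀ i, IsCompleteCycleOn (↑Δ.faces) k (zs i) ∧ vsupp (zs i) ⊆ vsupp z

/-- `σ` is a missing face (minimal nonface) of `Δ`: `σ` is not a face but all
its proper subsets are.  Its dimension is `σ.card - 1`. -/
def IsMissingFace (Δ : ASC V) (σ : Finset V) : Prop :=
  σ ∉ Δ.faces ∧ ∀ t ⊂ σ, t ∈ Δ.faces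

/-- The induced subcomplex `Δ|W` on a subset `W` of the vertices. -/
def induced (Δ : ASC V) (W : Finset V) : ASC V where
  faces := Δ.faces.filter fun s => s ⊆ W
  down_closed := by
    intro s t hs hts
    simp only [mem_filter] at hs ⊢
    exact ⟨Δ.down_closed hs.1 hts, hts.trans hs.2⟩

/-- `Δ` is `k`-Leray over `R`: the reduced homology `H̃ⱼ(Δ|W; R)` vanishes for
every `j ≥ k` and every vertex subset `W`. -/
def IsLeray (R : Type*) [CommRing R] (Δ : ASC V) (k : ℤ) : Prop :=
  ∀ (W : Finset V) (j : ℤ), k ≤ j → HVanish R (((induced Δ W).faces : Set (Finset V))) j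

/-- The closed star `St_σ Δ = ∪_{σ ⊆ τ ∈ Δ} 2^τ`. -/
def star (Δ : ASC V) (σ : Finset V) : ASC V where
  faces := Δ.faces.filter fun s => ∃ τ ∈ Δ.faces, σ ⊆ τ ∧ s ⊆ τ
  down_closed := by
    intro s t hs hts
    simp only [mem_filter] at hs ⊢
    obtain ⟨h1, τ', h2, h3, h4⟩ := hs
    exact ⟨Δ.down_closed h1 hts, τ', h2, h3, hts.trans h4⟩

/-- The deletion `Δ - σ`: the maximal subcomplex of `Δ` not containing `σ`. -/
def del (Δ : ASC V) (σ : Finset V) : ASC V where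
  faces := Δ.faces.filter fun s => ¬ σ ⊆ s
  down_closed := by
    intro s t hs hts
    simp only [mem_filter] at hs ⊢
    exact ⟨Δ.down_closed hs.1 hts, fun h => hs.2 (h.trans hts)⟩

/-- The extended link `eLk_σ Δ = St_σ Δ - σ`. -/
def eLk (Δ : ASC V) (σ : Finset V) : ASC V := del (star Δ σ) σ

/-- The link `Lk_σ Δ = {τ \ σ : σ ⊆ τ ∈ Δ}`. -/
def link (Δ : ASC V) (σ : Finset V) : ASC V where
  faces := Finset.univ.filter fun t => Disjoint σ t ∧ σ ∪ t ∈ Δ.faces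
  down_closed := by
    intro s t hs hts
    simp only [mem_filter, mem_univ, true_and] at hs ⊢
    exact ⟨hs.1.mono_right hts, Δ.down_closed hs.2 (union_subset_union_right hts)⟩

/-- The `k`-clique complex `Cl_k Δ`: faces are the sets of vertices of `Δ` all
of whose subsets of cardinality at most `k + 1` are faces of `Δ`. -/
def clique (Δ : ASC V) (k : ℤ) : ASC V where
  faces := Finset.univ.filter fun s =>
    (∀ v ∈ s, {v} ∈ Δ.faces) ∧ ∀ t ⊆ s, (t.card : ℤ) ≤ k + 1 → t ∈ Δ.faces
  down_closed := by
    intro s t hs hts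
    simp only [mem_filter, mem_univ, true_and] at hs ⊢
    exact ⟨fun v hv => hs.1 v (hts hv), fun u hu hc => hs.2 u (hu.trans hts) hc⟩

/-- The vertex set of a complex, as a set of elements of `V`. -/
def vertexSet (Δ : ASC V) : Set V := {v | {v} ∈ Δ.faces}

/-- The relative simplicial complex `(Δ, Γ)` is resolution `k`-chordal over `R`:
every relative `k`-cycle (a `k`-chain of `Δ` supported off `Γ` whose boundary
is a chain of `Γ`) admits a resolution, i.e. a `(k+1)`-chain `c` of `Δ`
supported off `Γ` with `∂c ≡ z` modulo chains of `Γ` and `vsupp c = vsupp z`. -/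
def RelResChordal (R : Type*) [CommRing R] (Δ Γ : ASC V) (k : ℤ) : Prop :=
  ∀ z : Finset V → R, IsChainOn (↑Δ.faces) k z → (∀ s, z s ≠ 0 → s ∉ Γ.faces) →
    IsChainOn (↑Γ.faces) (k - 1) (bdry z) →
    ∃ c : Finset V → R, IsChainOn (↑Δ.faces) (k + 1) c ∧ (∀ s, c s ≠ 0 → s ∉ Γ.faces) ∧
      IsChainOn (↑Γ.faces) k (bdry c - z) ∧ vsupp c = vsupp z

/-- The union of two simplicial complexes (taken facewise). -/
def aunion (Δ Γ : ASC V) : ASC V where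
  faces := Δ.faces ∪ Γ.faces
  down_closed := by
    intro s t hs hts
    rcases Finset.mem_union.1 hs with h | h
    · exact Finset.mem_union.2 (Or.inl (Δ.down_closed h hts))
    · exact Finset.mem_union.2 (Or.inr (Γ.down_closed h hts))

/-- The intersection of two simplicial complexes (taken facewise). -/
def ainter (Δ Γ : ASC V) : ASC V where
  faces := Δ.faces ∩ Γ.faces
  down_closed := by
    intro s t hs hts
    rw [Finset.mem_inter] at hs ⊢
    exact ⟨Δ.down_closed hs.1 hts, Γ.down_closed hs.2 hts⟩

/-- The `k`-skeleton of `Δ`: all faces of dimension at most `k`. -/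
def skel (Δ : ASC V) (k : ℤ) : ASC V where
  faces := Δ.faces.filter fun s => (s.card : ℤ) ≤ k + 1
  down_closed := by
    intro s t hs hts
    simp only [mem_filter] at hs ⊢
    refine ⟨Δ.down_closed hs.1 hts, le_trans ?_ hs.2⟩
    exact_mod_cast Finset.card_le_card hts

section Cone

set_option linter.unusedSectionVars false

variable {R : Type*} [CommRing R]

theorem esign_smul_esign_smul (v : V) (t : Finset V) (a : R) :
    esign v t • esign v t • a = a := by
  rw [smul_smul, esign, ← mul_pow]
  simp

theorem esign_insert {v w : V} {t : Finset V} (hv : v ∉ t) :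
    esign w (insert v t) = (if v < w then -1 else 1) * esign w t := by
  unfold esign
  rw [filter_insert]
  split_ifs with h
  · rw [card_insert_of_notMem (by simp [hv]), pow_succ']
  · simp

/-- The two signs picked up when adding `v` and `w` in either order are opposite. -/
theorem esign_mul_esign_insert {v w : V} {t : Finset V} (hv : v ∉ t) (hw : w ∉ t)
    (hvw : v ≠ w) :
    esign w t * esign v (insert w t) = -(esign v t * esign w (insert v t)) := by
  rw [esign_insert hv, esign_insert hw]
  rcases lt_or_gt_of_ne hvw with h | h
  · simp [h, h.not_gt, mul_comm]
  · simp [h, h.not_gt, mul_comm]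

theorem bdry_neg (c : Finset V → R) : bdry (-c) = -bdry c := by
  funext t
  simp [bdry]

theorem IsChainOn.bdry {Δ : ASC V} {k : ℤ} {c : Finset V → R}
    (hc : IsChainOn (↑Δ.faces) k c) : IsChainOn (↑Δ.faces) (k - 1) (bdry c) := by
  intro t ht
  obtain ⟨w, hw, hne⟩ := exists_ne_zero_of_sum_ne_zero ht
  obtain ⟨hmem, hcard⟩ := hc (insert w t) fun h => hne (by rw [h, smul_zero])
  rw [card_insert_of_notMem (mem_compl.1 hw)] at hcard
  exact ⟨Δ.down_closed hmem (subset_insert w t), by push_cast at hcard; lia⟩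

theorem IsChainOn.neg {S : Set (Finset V)} {k : ℤ} {c : Finset V → R}
    (hc : IsChainOn S k c) : IsChainOn S k (-c) :=
  fun s hs => hc s fun h => hs (by simp [h])

theorem IsChainOn.sub {S : Set (Finset V)} {k : ℤ} {c d : Finset V → R}
    (hc : IsChainOn S k c) (hd : IsChainOn S k d) : IsChainOn S k (c - d) := by
  intro s hs
  by_cases h : c s = 0
  · exact hd s fun h' => hs (by simp [h, h'])
  · exact hc s h

theorem vsupp_neg (c : Finset V → R) : vsupp (-c) = vsupp c := by
  simp [vsupp]

/-- The chain on faces avoiding `v` obtained by removing `v` from the faces of `z` containing it. -/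
def unconeChain (v : V) (z : Finset V → R) : Finset V → R :=
  fun t => if v ∈ t then 0 else esign v t • z (insert v t)

/-- The cone with apex `v` over a chain. -/
def coneChain (v : V) (y : Finset V → R) : Finset V → R :=
  fun s => if v ∈ s then esign v (s.erase v) • y (s.erase v) else 0

theorem unconeChain_coneChain {v : V} {y : Finset V → R} (hy : ∀ t, y t ≠ 0 → v ∉ t) :
    unconeChain v (coneChain v y) = y := by
  funext t
  by_cases ht : v ∈ t
  · simpa [unconeChain, ht] using (by_contra fun h => hy t h ht : y t = 0).symm
  · simp only [unconeChain, coneChain, ht, if_false, mem_insert_self, if_true,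
      erase_insert ht, esign_smul_esign_smul]

theorem mem_of_coneChain_ne_zero {v : V} {y : Finset V → R} {s : Finset V}
    (hs : coneChain v y s ≠ 0) : v ∈ s := by
  by_contra h
  simp [coneChain, h] at hs

theorem bdry_unconeChain_of_mem {v : V} {t : Finset V} (ht : v ∈ t) (z : Finset V → R) :
    bdry (unconeChain v z) t = 0 :=
  sum_eq_zero fun w _ => by simp [unconeChain, ht]

theorem bdry_unconeChain {v : V} {t : Finset V} (ht : v ∉ t) (z : Finset V → R) :
    bdry (unconeChain v z) t = -(esign v t • bdry z (insert v t)) := by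
  have hcompl : tᶜ = insert v (insert v t)ᶜ := by
    ext w
    by_cases h : w = v <;> simp [h, ht]
  rw [bdry, hcompl, sum_insert (by simp), bdry, smul_sum, ← sum_neg_distrib]
  simp only [unconeChain, mem_insert_self, if_true, smul_zero, zero_add]
  refine sum_congr rfl fun w hw => ?_
  simp only [mem_compl, mem_insert, not_or] at hw
  rw [if_neg (by simp [ht, Ne.symm hw.1]), smul_smul, smul_smul,
    esign_mul_esign_insert ht hw.2 (Ne.symm hw.1), neg_smul,
    insert_comm]

theorem vsupp_unconeChain {v : V} {z : Finset V → R} (hz : ∀ s, z s ≠ 0 → v ∈ s) :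
    vsupp (unconeChain v z) = vsupp z \ {v} := by
  ext w
  constructor
  · rintro ⟨t, ht, hw⟩
    have hvt : v ∉ t := fun h => ht (by simp [unconeChain, h])
    refine ⟨⟨insert v t, fun h => ht (by simp [unconeChain, h]), mem_insert_of_mem hw⟩, ?_⟩
    rintro rfl
    exact hvt hw
  · rintro ⟨⟨s, hs, hw⟩, hwv⟩
    refine ⟨s.erase v, fun h => hs ?_, mem_erase.2 ⟨hwv, hw⟩⟩
    rw [unconeChain, if_neg (notMem_erase v s), insert_erase (hz s hs)] at h
    rw [← esign_smul_esign_smul v (s.erase v) (z s), h, smul_zero]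

theorem mem_vsupp_of_ne_zero {v : V} {z : Finset V → R} (hz : ∀ s, z s ≠ 0 → v ∈ s)
    (h : z ≠ 0) : v ∈ vsupp z := by
  obtain ⟨s, hs⟩ := Function.ne_iff.1 h
  exact ⟨s, hs, hz s hs⟩

theorem mem_star_singleton {Δ : ASC V} {v : V} {s : Finset V} (hs : v ∈ s) :
    s ∈ (star Δ {v}).faces ↔ s ∈ Δ.faces := by
  simp only [_root_.star, mem_filter, and_iff_left_iff_imp]
  exact fun h => ⟨s, h, by simpa using hs, Subset.rfl⟩

theorem mem_del_singleton {Γ : ASC V} {v : V} {s : Finset V} :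
    s ∈ (del Γ {v}).faces ↔ s ∈ Γ.faces ∧ v ∉ s := by
  simp [del]

theorem mem_link_singleton {Δ : ASC V} {v : V} {t : Finset V} :
    t ∈ (link Δ {v}).faces ↔ v ∉ t ∧ insert v t ∈ Δ.faces := by
  rw [link, mem_filter, disjoint_singleton_left, ← insert_eq]
  simp

theorem isChainOn_unconeChain {Δ : ASC V} {v : V} {k : ℤ} {z : Finset V → R}
    (hz : IsChainOn (↑(star Δ {v}).faces) k z) :
    IsChainOn (↑(link Δ {v}).faces) (k - 1) (unconeChain v z) := by
  intro t ht
  have hvt : v ∉ t := fun h => ht (by simp [unconeChain, h])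
  obtain ⟨hmem, hcard⟩ := hz (insert v t) fun h => ht (by simp [unconeChain, h])
  rw [card_insert_of_notMem hvt] at hcard
  exact ⟨mem_link_singleton.2 ⟨hvt, (mem_star_singleton (mem_insert_self v t)).1 hmem⟩,
    by push_cast at hcard; lia⟩

theorem isChainOn_coneChain {Δ : ASC V} {v : V} {k : ℤ} {y : Finset V → R}
    (hy : IsChainOn (↑(link Δ {v}).faces) (k - 1) y) :
    IsChainOn (↑(star Δ {v}).faces) k (coneChain v y) := by
  intro s hs
  have hvs := mem_of_coneChain_ne_zero hs
  obtain ⟨hmem, hcard⟩ := hy (s.erase v) fun h => hs (by simp [coneChain, h])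
  have hface := (mem_link_singleton.1 hmem).2
  rw [insert_erase hvs] at hface
  have := card_erase_add_one hvs
  exact ⟨(mem_star_singleton hvs).2 hface, by lia⟩

theorem notMem_of_isChainOn_link {Δ : ASC V} {v : V} {k : ℤ} {y : Finset V → R}
    (hy : IsChainOn (↑(link Δ {v}).faces) k y) (t : Finset V) (ht : y t ≠ 0) : v ∉ t :=
  (mem_link_singleton.1 (hy t ht).1).1

theorem isChainOn_del_singleton_iff {Γ : ASC V} {v : V} {k : ℤ} {c : Finset V → R}
    (hc : IsChainOn (↑Γ.faces) k c) :
    IsChainOn (↑(del Γ {v}).faces) k c ↔ ∀ t, v ∉ t → c (insert v t) = 0 := by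
  constructor
  · intro h t _
    by_contra hne
    exact (mem_del_singleton.1 (h _ hne).1).2 (mem_insert_self v t)
  · intro h s hs
    refine ⟨mem_del_singleton.2 ⟨(hc s hs).1, fun hvs => hs ?_⟩, (hc s hs).2⟩
    rw [← insert_erase hvs]
    exact h _ (notMem_erase v s)

theorem notMem_del_singleton_iff {Γ : ASC V} {v : V} {k : ℤ} {c : Finset V → R}
    (hc : IsChainOn (↑Γ.faces) k c) :
    (∀ s, c s ≠ 0 → s ∉ (del Γ {v}).faces) ↔ ∀ s, c s ≠ 0 → v ∈ s := by
  refine forall₂_congr fun s hs => ?_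
  have : s ∈ Γ.faces := (hc s hs).1
  simp [mem_del_singleton, this]

theorem esign_smul_eq_zero_iff (v : V) (t : Finset V) (a : R) :
    esign v t • a = 0 ↔ a = 0 :=
  ⟨fun h => by rw [← esign_smul_esign_smul v t a, h, smul_zero], fun h => by rw [h, smul_zero]⟩

theorem bdry_unconeChain_eq_zero_iff {v : V} {z : Finset V → R} :
    bdry (unconeChain v z) = 0 ↔ ∀ t, v ∉ t → bdry z (insert v t) = 0 := by
  refine ⟨fun h t ht => ?_, fun h => funext fun t => ?_⟩
  · have := congrFun h t
    rwa [bdry_unconeChain ht, Pi.zero_apply, neg_eq_zero, esign_smul_eq_zero_iff] at this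
  · by_cases ht : v ∈ t
    · exact bdry_unconeChain_of_mem ht z
    · rw [bdry_unconeChain ht, h t ht, smul_zero, neg_zero, Pi.zero_apply]

/-- Removing the apex anticommutes with the boundary, relative to the faces avoiding the apex. -/
theorem bdry_neg_unconeChain_eq_iff {v : V} {c z : Finset V → R} :
    bdry (-unconeChain v c) = unconeChain v z ↔
      ∀ t, v ∉ t → (bdry c - z) (insert v t) = 0 := by
  rw [bdry_neg, funext_iff]
  refine forall_congr' fun t => ?_
  by_cases ht : v ∈ t
  · simp [ht, bdry_unconeChain_of_mem, unconeChain]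
  · rw [Pi.neg_apply, bdry_unconeChain ht, neg_neg, unconeChain, if_neg ht, ← sub_eq_zero,
      ← smul_sub, esign_smul_eq_zero_iff]
    simp [ht]

theorem unconeChain_neg (v : V) (z : Finset V → R) :
    unconeChain v (-z) = -unconeChain v z := by
  funext t
  by_cases ht : v ∈ t <;> simp [unconeChain, ht]

end Cone

/-- **Cone Lemma** (Lemma 4.1): for a vertex `v` of `Δ`, the relative complex
`(St_v Δ, St_v Δ - v)` is resolution `k`-chordal over `R` if and only if
`Lk_v Δ` is resolution `(k-1)`-chordal over `R`. -/
theorem cone_lemma {V : Type*} [Fintype V] [LinearOrder V]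
    (R : Type*) [CommRing R] (Δ : ASC V) (v : V) (hv : {v} ∈ Δ.faces)
    (k : ℤ) (hk : 0 ≤ k) :
    RelResChordal R (star Δ {v}) (del (star Δ {v}) {v}) k ↔
      ResChordal R (link Δ {v}) (k - 1) := by
  constructor
  · intro h y hy hbd
    have hyv := unconeChain_coneChain (notMem_of_isChainOn_link hy)
    have hz := isChainOn_coneChain hy
    have hzv : ∀ s, coneChain v y s ≠ 0 → v ∈ s := fun s => mem_of_coneChain_ne_zero
    obtain ⟨c, hc, hcv, hcz, hsupp⟩ := h (coneChain v y) hz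
      ((notMem_del_singleton_iff hz).2 hzv)
      ((isChainOn_del_singleton_iff hz.bdry).2
        (bdry_unconeChain_eq_zero_iff.1 (by rw [hyv, hbd])))
    rw [notMem_del_singleton_iff hc] at hcv
    have hb : IsChainOn (↑(star Δ {v}).faces) k (bdry c) := by simpa using hc.bdry
    rw [isChainOn_del_singleton_iff (hb.sub hz), ← bdry_neg_unconeChain_eq_iff, hyv] at hcz
    refine ⟨-unconeChain v c, ?_, hcz, ?_⟩
    · rw [show k - 1 + 1 = k + 1 - 1 by ring]
      exact (isChainOn_unconeChain hc).neg
    · rw [vsupp_neg, vsupp_unconeChain hcv, hsupp, ← vsupp_unconeChain hzv, hyv]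
  · intro h z hz hzv hbd
    rw [notMem_del_singleton_iff hz] at hzv
    rw [isChainOn_del_singleton_iff hz.bdry, ← bdry_unconeChain_eq_zero_iff] at hbd
    by_cases hz0 : z = 0
    · subst hz0
      exact ⟨0, fun s hs => absurd rfl hs, fun s hs => absurd rfl hs,
        fun s hs => absurd (by simp [bdry]) hs, rfl⟩
    obtain ⟨d, hd, hdz, hsupp⟩ := h (unconeChain v z) (isChainOn_unconeChain hz) hbd
    rw [show k - 1 + 1 = k + 1 - 1 by ring] at hd
    have hc := (isChainOn_coneChain hd).neg
    have hcv : ∀ s, (-coneChain v d) s ≠ 0 → v ∈ s :=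
      fun s hs => mem_of_coneChain_ne_zero (neg_ne_zero.1 hs)
    have hdc : -unconeChain v (-coneChain v d) = d := by
      rw [unconeChain_neg, neg_neg, unconeChain_coneChain (notMem_of_isChainOn_link hd)]
    have hb : IsChainOn (↑(star Δ {v}).faces) k (bdry (-coneChain v d)) := by
      simpa using hc.bdry
    have hrel := bdry_neg_unconeChain_eq_iff.1 (hdc.symm ▸ hdz)
    refine ⟨-coneChain v d, hc, (notMem_del_singleton_iff hc).2 hcv,
      (isChainOn_del_singleton_iff (hb.sub hz)).2 hrel, ?_⟩
    have hc0 : -coneChain v d ≠ 0 := by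
      intro h0
      apply hz0
      funext s
      by_contra hs
      have := hrel (s.erase v) (notMem_erase v s)
      rw [insert_erase (hzv s hs), h0] at this
      exact hs (by simpa [bdry] using this)
    have hdiff : vsupp (-coneChain v d) \ {v} = vsupp z \ {v} := by
      rw [← vsupp_unconeChain hcv, ← vsupp_unconeChain hzv, ← hsupp, ← hdc, vsupp_neg, hdc]
    rw [← Set.insert_eq_of_mem (mem_vsupp_of_ne_zero hcv hc0),
      ← Set.insert_eq_of_mem (mem_vsupp_of_ne_zero hzv hz0),
      ← Set.insert_sdiff_singleton, hdiff, Set.insert_sdiff_singleton]
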